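/- arXiv:2206.09546 — 4 statements merged into one kernel-verified Lean document; each statement's English description precedes it below -/
import Mathlib

section
/- Let Π be a finite nonempty set, and let J, g : Π → ℝ be functions with J(π) ≥ 0 for every π ∈ Π. Let π' ∈ Π satisfy g(π') ≤ g(π) for all π ∈ Π (a gain-optimal element), and suppose the set D = {π ∈ Π : g(π) ≠ g(π')} is nonempty. Define λ* = (max_{π ∈ Π} J(π)) / (min_{π ∈ D} (g(π) − g(π'))). Then for every real λ > λ* and every π ∈ D, it holds that J(π') + λ·g(π') < J(π) + λ·g(π). -/
/-- For a finite nonempty policy set, nonnegative transient costs `J`,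
gains `g`, a gain-optimal `π'`, and nonempty set `D = {π | g π ≠ g π'}`, any
`λ > λ* = (max J) / (min_{π ∈ D} (g π - g π'))` makes `π'` strictly better than
every `π ∈ D` for the combined objective `J + λ·g`. -/
theorem gain_optimal_policy_preferred {P : Type*} [Fintype P] [Nonempty P]
    (J g : P → ℝ) (hJ : ∀ π, 0 ≤ J π)
    (π' : P) (hopt : ∀ π, g π' ≤ g π)
    (hD : (Finset.univ.filter (fun π => g π ≠ g π')).Nonempty)
    (lam : ℝ)
    (hlam : lam > (Finset.univ.sup' Finset.univ_nonempty J) /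
      ((Finset.univ.filter (fun π => g π ≠ g π')).inf' hD (fun π => g π - g π'))) :
    ∀ π, g π ≠ g π' → J π' + lam * g π' < J π + lam * g π := by
  intro π hπ
  set M := Finset.univ.sup' Finset.univ_nonempty J
  set m := (Finset.univ.filter (fun π => g π ≠ g π')).inf' hD (fun π => g π - g π')
  have hJM : J π' ≤ M := Finset.le_sup' J (Finset.mem_univ π')
  have hm_le : m ≤ g π - g π' :=
    Finset.inf'_le (fun π => g π - g π') (Finset.mem_filter.2 ⟨Finset.mem_univ π, hπ⟩)
  have hm_pos : 0 < m := by
    refine (Finset.lt_inf'_iff hD).2 fun σ hσ => sub_pos.2 ?_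
    exact lt_of_le_of_ne (hopt σ) (Finset.mem_filter.1 hσ).2.symm
  have hM_lt : M < lam * m := (div_lt_iff₀ hm_pos).1 hlam
  have hlam_nonneg : 0 ≤ lam :=
    (div_nonneg ((hJ π').trans hJM) hm_pos.le).trans hlam.le
  have hmul : lam * m ≤ lam * (g π - g π') := mul_le_mul_of_nonneg_left hm_le hlam_nonneg
  linarith [hJ π]
end

section
/- Let ζ, δ, K be real numbers with 0 < ζ ≤ 1, 0 < δ < 1, and K ≥ 1. If a natural number n satisfies n ≥ (2/ζ²)·log(16·K/(ζ⁴·δ)) + 3, then log(4·n²·K/δ) ≤ ζ²·(n − 1). -/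
/-- The logarithm is bounded by half the identity on the positive reals. -/
theorem two_mul_log_le_self {t : ℝ} (ht : 0 < t) : 2 * Real.log t ≤ t := by
  have h := Real.log_le_sub_one_of_pos (half_pos ht)
  have h2 := Real.log_le_sub_one_of_pos (zero_lt_two (α := ℝ))
  rw [Real.log_div ht.ne' two_ne_zero] at h
  linarith

/-- explicit sample-size inversion: if `0 < ζ ≤ 1`, `0 < δ < 1`,
`K ≥ 1`, and the natural number `n` satisfies
`n ≥ (2/ζ²)·log(16K/(ζ⁴δ)) + 3`, then `log(4n²K/δ) ≤ ζ²·(n − 1)`. -/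
theorem sample_size_inversion (ζ δ K : ℝ) (hζ0 : 0 < ζ) (hζ1 : ζ ≤ 1)
    (hδ0 : 0 < δ) (hδ1 : δ < 1) (hK : 1 ≤ K) (n : ℕ)
    (hn : (n : ℝ) ≥ 2 / ζ ^ 2 * Real.log (16 * K / (ζ ^ 4 * δ)) + 3) :
    Real.log (4 * (n : ℝ) ^ 2 * K / δ) ≤ ζ ^ 2 * ((n : ℝ) - 1) := by
  have hK0 : 0 < K := by linarith
  have hx0 : 0 < ζ ^ 2 := by positivity
  have hL : 0 ≤ Real.log (16 * K / (ζ ^ 4 * δ)) := by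
    apply Real.log_nonneg
    rw [one_le_div (by positivity)]
    have h4 : ζ ^ 4 ≤ 1 := pow_le_one₀ hζ0.le hζ1
    nlinarith [mul_le_mul h4 hδ1.le hδ0.le zero_le_one]
  have hn0 : (0 : ℝ) < n := by
    have : 0 ≤ 2 / ζ ^ 2 * Real.log (16 * K / (ζ ^ 4 * δ)) := by positivity
    linarith
  have hsplit : Real.log (4 * (n : ℝ) ^ 2 * K / δ) =
      Real.log (16 * K / (ζ ^ 4 * δ)) + 2 * Real.log (ζ ^ 2 * n / 2) := by
    have hfac : 4 * (n : ℝ) ^ 2 * K / δ =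
        16 * K / (ζ ^ 4 * δ) * (ζ ^ 2 * n / 2) ^ 2 := by
      field_simp
      ring
    rw [hfac, Real.log_mul (by positivity) (by positivity), Real.log_pow]
    norm_num
  have hlog : 2 * Real.log (ζ ^ 2 * n / 2) ≤ ζ ^ 2 * n / 2 :=
    two_mul_log_le_self (by positivity)
  have hscaled : 2 * Real.log (16 * K / (ζ ^ 4 * δ)) + 3 * ζ ^ 2 ≤ ζ ^ 2 * n := by
    calc 2 * Real.log (16 * K / (ζ ^ 4 * δ)) + 3 * ζ ^ 2
        = ζ ^ 2 * (2 / ζ ^ 2 * Real.log (16 * K / (ζ ^ 4 * δ)) + 3) := by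
          rw [mul_add, ← mul_assoc, mul_div_cancel₀ _ hx0.ne', mul_comm 3]
      _ ≤ ζ ^ 2 * n := mul_le_mul_of_nonneg_left hn hx0.le
  rw [hsplit]
  linarith
end

section
/- Let X be an invertible n×n real matrix and y, b ∈ ℝⁿ with X·y = b, where ‖M‖ denotes the operator norm of a matrix M induced by the supremum norm on ℝⁿ (the maximum over rows of the sum of absolute values of the entries), and ‖v‖∞ denotes the supremum norm of a vector v. Let a > 0, c > 0, ε > 0, and define η* = ε / ( ‖X⁻¹‖·(c + a·‖y‖∞) + ε·a·‖X⁻¹‖ ). Then for every η with 0 ≤ η ≤ η*, every n×n matrix E with ‖E‖ ≤ a·η, every vector d ∈ ℝⁿ with ‖d‖∞ ≤ c·η, and every y' ∈ ℝⁿ with (X+E)·y' = b + d, one has ‖y' − y‖∞ ≤ ε. -/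
/-- The operator norm of a square real matrix induced by the supremum norm on `ℝⁿ`:
the maximum over rows of the sum of absolute values of the entries. -/
noncomputable def matOpNorm {n : ℕ} (M : Matrix (Fin n) (Fin n) ℝ) : ℝ :=
  ⨆ i, ∑ j, |M i j|

/-- The supremum norm of a vector in `ℝⁿ`. -/
noncomputable def vecSupNorm {n : ℕ} (v : Fin n → ℝ) : ℝ :=
  ⨆ i, |v i|

theorem abs_apply_le_vecSupNorm {n : ℕ} (v : Fin n → ℝ) (i : Fin n) :
    |v i| ≤ vecSupNorm v :=
  le_ciSup (f := fun i => |v i|) (Set.finite_range _).bddAbove i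

theorem sum_abs_row_le_matOpNorm {n : ℕ} (M : Matrix (Fin n) (Fin n) ℝ) (i : Fin n) :
    ∑ j, |M i j| ≤ matOpNorm M :=
  le_ciSup (f := fun i => ∑ j, |M i j|) (Set.finite_range _).bddAbove i

theorem vecSupNorm_nonneg {n : ℕ} (v : Fin n → ℝ) : 0 ≤ vecSupNorm v :=
  Real.iSup_nonneg fun _ => abs_nonneg _

theorem matOpNorm_nonneg {n : ℕ} (M : Matrix (Fin n) (Fin n) ℝ) : 0 ≤ matOpNorm M :=
  Real.iSup_nonneg fun _ => Finset.sum_nonneg fun _ _ => abs_nonneg _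

theorem vecSupNorm_sub_le {n : ℕ} (u v : Fin n → ℝ) :
    vecSupNorm (u - v) ≤ vecSupNorm u + vecSupNorm v :=
  Real.iSup_le (fun i => (abs_sub (u i) (v i)).trans
      (add_le_add (abs_apply_le_vecSupNorm u i) (abs_apply_le_vecSupNorm v i)))
    (add_nonneg (vecSupNorm_nonneg u) (vecSupNorm_nonneg v))

theorem vecSupNorm_mulVec_le {n : ℕ} (M : Matrix (Fin n) (Fin n) ℝ) (v : Fin n → ℝ) :
    vecSupNorm (M.mulVec v) ≤ matOpNorm M * vecSupNorm v := by
  refine Real.iSup_le (fun i => ?_) (mul_nonneg (matOpNorm_nonneg M) (vecSupNorm_nonneg v))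
  calc |M.mulVec v i| ≤ ∑ j, |M i j * v j| :=
        Finset.abs_sum_le_sum_abs (fun j => M i j * v j) Finset.univ
    _ ≤ ∑ j, |M i j| * vecSupNorm v := by
        refine Finset.sum_le_sum fun j _ => ?_
        rw [abs_mul]
        exact mul_le_mul_of_nonneg_left (abs_apply_le_vecSupNorm v j) (abs_nonneg _)
    _ = (∑ j, |M i j|) * vecSupNorm v := (Finset.sum_mul ..).symm
    _ ≤ matOpNorm M * vecSupNorm v :=
        mul_le_mul_of_nonneg_right (sum_abs_row_le_matOpNorm M i) (vecSupNorm_nonneg v)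

/-- The error of a perturbed linear system, bounded in terms of the error itself. -/
theorem vecSupNorm_sub_le_of_perturbed {n : ℕ} {X E : Matrix (Fin n) (Fin n) ℝ}
    (hX : IsUnit X) {y y' d : Fin n → ℝ} (h : (X + E).mulVec y' = X.mulVec y + d) :
    vecSupNorm (y' - y) ≤ matOpNorm X⁻¹ *
      (vecSupNorm d + matOpNorm E * vecSupNorm y + matOpNorm E * vecSupNorm (y' - y)) := by
  have hdet : IsUnit X.det := (Matrix.isUnit_iff_isUnit_det X).1 hX
  have hres : X.mulVec (y' - y) = d - E.mulVec y - E.mulVec (y' - y) := by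
    rw [Matrix.add_mulVec] at h
    rw [Matrix.mulVec_sub, Matrix.mulVec_sub, eq_sub_of_add_eq h]
    abel
  have hsol : y' - y = X⁻¹.mulVec (d - E.mulVec y - E.mulVec (y' - y)) := by
    rw [← hres, Matrix.mulVec_mulVec, Matrix.nonsing_inv_mul X hdet, Matrix.one_mulVec]
  calc vecSupNorm (y' - y)
      = vecSupNorm (X⁻¹.mulVec (d - E.mulVec y - E.mulVec (y' - y))) := congrArg _ hsol
    _ ≤ matOpNorm X⁻¹ * vecSupNorm (d - E.mulVec y - E.mulVec (y' - y)) :=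
        vecSupNorm_mulVec_le _ _
    _ ≤ _ := by
        refine mul_le_mul_of_nonneg_left ?_ (matOpNorm_nonneg _)
        linarith [vecSupNorm_sub_le (d - E.mulVec y) (E.mulVec (y' - y)),
          vecSupNorm_sub_le d (E.mulVec y), vecSupNorm_mulVec_le E y,
          vecSupNorm_mulVec_le E (y' - y)]

/-- η-greedy approximation, quantitative form: with `X` invertible,
`X·y = b`, and `η* = ε / (‖X⁻¹‖·(c + a·‖y‖∞) + ε·a·‖X⁻¹‖)`, for every
`0 ≤ η ≤ η*`, every perturbation `E` with `‖E‖ ≤ a·η`, every `d` with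
`‖d‖∞ ≤ c·η`, and every solution `y'` of `(X+E)·y' = b + d`, one has
`‖y' − y‖∞ ≤ ε`. -/
theorem eta_greedy_perturbation {n : ℕ} (X : Matrix (Fin n) (Fin n) ℝ)
    (hX : IsUnit X) (y b : Fin n → ℝ) (hXy : X.mulVec y = b)
    (a c ε : ℝ) (ha : 0 < a) (hc : 0 < c) (hε : 0 < ε) :
    ∀ η : ℝ, 0 ≤ η →
      η ≤ ε / (matOpNorm X⁻¹ * (c + a * vecSupNorm y) + ε * a * matOpNorm X⁻¹) →
      ∀ E : Matrix (Fin n) (Fin n) ℝ, matOpNorm E ≤ a * η →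
      ∀ d : Fin n → ℝ, vecSupNorm d ≤ c * η →
      ∀ y' : Fin n → ℝ, (X + E).mulVec y' = b + d →
      vecSupNorm (y' - y) ≤ ε := by
  intro η hη hle E hE d hd y' hy'
  subst hXy
  have hbound := vecSupNorm_sub_le_of_perturbed hX hy'
  have hK := matOpNorm_nonneg X⁻¹
  have hY := vecSupNorm_nonneg y
  have hZ := vecSupNorm_nonneg (y' - y)
  generalize vecSupNorm (y' - y) = z at *
  generalize vecSupNorm y = s at *
  generalize matOpNorm X⁻¹ = K at *
  have hz : z ≤ K * (c * η + a * η * s + a * η * z) := by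
    refine hbound.trans (mul_le_mul_of_nonneg_left ?_ hK)
    gcongr
  have hq : 0 < c + a * s := by positivity
  rcases (mul_nonneg hK hη).eq_or_lt with h0 | hpos
  · have : K * (c * η + a * η * s + a * η * z) = K * η * (c + a * s + a * z) := by ring
    rw [this, ← h0, zero_mul] at hz
    exact hz.trans hε.le
  · have hKpos : 0 < K := pos_of_mul_pos_left hpos hη
    rw [le_div_iff₀ (by positivity)] at hle
    have hp : 0 < K * η * (c + a * s) := mul_pos hpos hq
    have hcontr : 0 < 1 - K * a * η :=
      pos_of_mul_pos_right (a := ε) (by linarith) hε.le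
    refine le_of_mul_le_mul_right ?_ hcontr
    linarith
end

section
/- Let β be a real number with 0 < β < 1, let N be a positive integer, and let h : {0, 1, …, N} → ℝ satisfy h(N) = 0 and h(i) = 1 + β·h(i+1) + (1−β)·h(0) for every i with 0 ≤ i < N. Then h(0) = (1 − β^N) / (β^N · (1 − β)). -/
/-- worst-case chain hitting time: if `0 < β < 1`, `N ≥ 1`, and
`h : {0,…,N} → ℝ` satisfies `h N = 0` and `h i = 1 + β·h(i+1) + (1−β)·h 0` for
every `i < N`, then `h 0 = (1 − β^N) / (β^N · (1 − β))`. -/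
theorem chain_hitting_time (β : ℝ) (hβ0 : 0 < β) (hβ1 : β < 1)
    (N : ℕ) (hN : 0 < N) (h : ℕ → ℝ)
    (hend : h N = 0)
    (hrec : ∀ i : ℕ, i < N → h i = 1 + β * h (i + 1) + (1 - β) * h 0) :
    h 0 = (1 - β ^ N) / (β ^ N * (1 - β)) := by
  have key : ∀ k ≤ N, β ^ k * (1 - β) * (h 0 - h k) = 1 - β ^ k := by
    intro k
    induction k with
    | zero => simp
    | succ k ih =>
      intro hk
      linear_combination ih (by omega) + β ^ k * (1 - β) * hrec k hk
  have hpos : 0 < β ^ N * (1 - β) := mul_pos (pow_pos hβ0 N) (sub_pos.mpr hβ1)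
  rw [eq_div_iff hpos.ne', mul_comm, ← key N le_rfl, hend, sub_zero]
end
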